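/- arXiv:1711.11187 — 5 statements merged into one kernel-verified Lean document; each statement's English description precedes it below -/
import Mathlib

section
/- Let N ≥ 1, let b be a real number with −N < b < 1, let p > 1 + (2−b)/N, and set r_* := N(p−1)/(2−b) > 1. Let Γ : ℝ^N × ℝ^N × (0,∞) → ℝ be a measurable nonnegative kernel satisfying (K1), (K2), and the upper Gaussian-type bound: there exist C₀, c₀ > 0 such that Γ(x,y,t) ≤ C₀ t^{−N/(2−b)} exp(−c₀ (|x−y|^{(2−b)}/t)^{1/(1−b)}) for all x, y ∈ ℝ^N and t > 0. Then there exists δ > 0 such that for every nonnegative φ ∈ L^∞(ℝ^N) with ‖φ‖_{r_*,∞} < δ, there exists a global-in-time mild solution u of u_t = div(w∇u) + u^p with kernel Γ and initial data φ, and it satisfies sup_{t>0} (1+t)^{(N/(2−b))(1/r_* − 1/q)} ‖u(·,t)‖_{q,∞} < ∞ for every q with r_* ≤ q ≤ ∞. -/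
open MeasureTheory Real Set
open scoped ENNReal

noncomputable section

/-- `N`-dimensional Euclidean space. -/
abbrev E (N : ℕ) : Type := EuclideanSpace ℝ (Fin N)

/-- A mild solution of `u_t = div(w ∇u) + u^p` with kernel `Γ` and initial data `φ`
on `ℝ^N × (0,T)` (`T ∈ (0,∞]`): a nonnegative measurable function, essentially bounded
on `ℝ^N × (0,T)`, satisfying the Duhamel integral identity (with all integrals finite). -/
def IsMildSolution (N : ℕ) (p : ℝ) (Γ : E N → E N → ℝ → ℝ)
    (φ : E N → ℝ) (T : ℝ≥0∞) (u : E N → ℝ → ℝ) : Prop :=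
  Measurable (fun q : E N × ℝ => u q.1 q.2) ∧
  (∀ x t, 0 ≤ u x t) ∧
  (∃ M : ℝ, ∀ t : ℝ, 0 < t → ENNReal.ofReal t < T →
    ∀ᵐ x : E N ∂volume, u x t ≤ M) ∧
  (∀ t : ℝ, 0 < t → ENNReal.ofReal t < T →
    ∀ᵐ x : E N ∂volume,
      Integrable (fun y => Γ x y t * φ y) volume ∧
      Integrable (fun q : E N × ℝ => Γ x q.1 (t - q.2) * u q.1 q.2 ^ p)
        (volume.prod (volume.restrict (Ioo (0:ℝ) t))) ∧
      u x t = (∫ y, Γ x y t * φ y) +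
        ∫ s in Ioo (0:ℝ) t, ∫ y, Γ x y (t - s) * u y s ^ p)

/-- The weak `L^r` quasinorm `‖f‖_{r,∞} = sup_{λ>0} λ |{|f|>λ}|^{1/r}`. -/
def weakNorm (N : ℕ) (r : ℝ) (f : E N → ℝ) : ℝ≥0∞ :=
  ⨆ (l : ℝ) (_ : 0 < l), ENNReal.ofReal l * (volume {x : E N | l < |f x|}) ^ (1 / r)


section Kernel

variable {X : Type*} [MeasurableSpace X]

/-- The linear evolution `∫ K(x,y,t) φ(y) dμ(y)` of a datum `φ` under the kernel `K`. -/
def kernelEvolution (μ : Measure X) (K : X → X → ℝ → ℝ≥0∞) (φ : X → ℝ≥0∞) (x : X) (t : ℝ) :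
    ℝ≥0∞ :=
  ∫⁻ y, K x y t * φ y ∂μ

/-- The right-hand side of the Duhamel identity with nonlinearity `u ↦ u ^ p`. -/
def duhamel (μ : Measure X) (K : X → X → ℝ → ℝ≥0∞) (p : ℝ) (φ : X → ℝ≥0∞)
    (u : X → ℝ → ℝ≥0∞) (x : X) (t : ℝ) : ℝ≥0∞ :=
  kernelEvolution μ K φ x t + ∫⁻ s in Ioo (0 : ℝ) t, ∫⁻ y, K x y (t - s) * u y s ^ p ∂μ

/-- The Picard iterates of the Duhamel map, started from zero. -/
def picard (μ : Measure X) (K : X → X → ℝ → ℝ≥0∞) (p : ℝ) (φ : X → ℝ≥0∞) :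
    ℕ → X → ℝ → ℝ≥0∞
  | 0 => 0
  | n + 1 => duhamel μ K p φ (picard μ K p φ n)

variable {μ : Measure X} {K : X → X → ℝ → ℝ≥0∞} {p : ℝ} {φ : X → ℝ≥0∞}

lemma kernelEvolution_mono {φ' : X → ℝ≥0∞} (h : φ ≤ᵐ[μ] φ') (x : X) (t : ℝ) :
    kernelEvolution μ K φ x t ≤ kernelEvolution μ K φ' x t := by
  refine lintegral_mono_ae ?_
  filter_upwards [h] with y hy
  gcongr

lemma measurable_kernelEvolution [SFinite μ]
    (hK : Measurable fun q : X × X × ℝ => K q.1 q.2.1 q.2.2) (hφ : Measurable φ) :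
    Measurable fun q : X × ℝ => kernelEvolution μ K φ q.1 q.2 := by
  refine Measurable.lintegral_prod_right' (f := fun r : (X × ℝ) × X =>
    K r.1.1 r.2 r.1.2 * φ r.2) ?_
  exact (hK.comp (g := fun q : X × X × ℝ => K q.1 q.2.1 q.2.2)
    (f := fun r : (X × ℝ) × X => (r.1.1, r.2, r.1.2)) (by fun_prop)).mul (by fun_prop)

lemma kernelEvolution_const (hK1 : ∀ x t, 0 < t → ∫⁻ y, K x y t ∂μ = 1)
    (hK : Measurable fun q : X × X × ℝ => K q.1 q.2.1 q.2.2) (c : ℝ≥0∞) (x : X) {t : ℝ}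
    (ht : 0 < t) : kernelEvolution μ K (fun _ => c) x t = c := by
  have hm : Measurable fun y => K x y t :=
    hK.comp (f := fun y => (x, y, t)) (by fun_prop)
  rw [kernelEvolution, lintegral_mul_const _ hm, hK1 x t ht, one_mul]

/-- Jensen's inequality for a kernel of total mass one. -/
lemma kernelEvolution_le_rpow (hK : Measurable fun q : X × X × ℝ => K q.1 q.2.1 q.2.2)
    (hK1 : ∀ x t, 0 < t → ∫⁻ y, K x y t ∂μ = 1) (hφ : Measurable φ) {a : ℝ} (ha : 1 ≤ a)
    (x : X) {t : ℝ} (ht : 0 < t) :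
    kernelEvolution μ K φ x t ≤ kernelEvolution μ K (fun y => φ y ^ a) x t ^ (1 / a) := by
  have hm : Measurable fun y => K x y t :=
    hK.comp (f := fun y => (x, y, t)) (by fun_prop)
  have : IsProbabilityMeasure (μ.withDensity fun y => K x y t) :=
    ⟨by rw [withDensity_apply _ MeasurableSet.univ, setLIntegral_univ, hK1 x t ht]⟩
  have h := eLpNorm'_le_eLpNorm'_of_exponent_le one_pos ha (μ.withDensity fun y => K x y t)
    (f := φ) hφ.aestronglyMeasurable
  simp only [eLpNorm', enorm_eq_self, ENNReal.rpow_one, div_one] at h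
  rwa [lintegral_withDensity_eq_lintegral_mul _ hm hφ,
    lintegral_withDensity_eq_lintegral_mul _ hm (hφ.pow_const a)] at h

lemma measurable_duhamel_integrand [SFinite μ]
    (hK : Measurable fun q : X × X × ℝ => K q.1 q.2.1 q.2.2) {u : X → ℝ → ℝ≥0∞}
    (hu : Measurable fun q : X × ℝ => u q.1 q.2) (p : ℝ) :
    Measurable fun r : (X × ℝ) × ℝ => ∫⁻ y, K r.1.1 y (r.1.2 - r.2) * u y r.2 ^ p ∂μ := by
  refine Measurable.lintegral_prod_right' (f := fun r : ((X × ℝ) × ℝ) × X =>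
    K r.1.1.1 r.2 (r.1.1.2 - r.1.2) * u r.2 r.1.2 ^ p) ?_
  refine (hK.comp (g := fun q : X × X × ℝ => K q.1 q.2.1 q.2.2)
    (f := fun r : ((X × ℝ) × ℝ) × X => (r.1.1.1, r.2, r.1.1.2 - r.1.2)) (by fun_prop)).mul ?_
  exact (hu.comp (g := fun q : X × ℝ => u q.1 q.2)
    (f := fun r : ((X × ℝ) × ℝ) × X => (r.2, r.1.2)) (by fun_prop)).pow_const p

lemma measurable_duhamel [SFinite μ] (hK : Measurable fun q : X × X × ℝ => K q.1 q.2.1 q.2.2)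
    (hφ : Measurable φ) {u : X → ℝ → ℝ≥0∞} (hu : Measurable fun q : X × ℝ => u q.1 q.2) :
    Measurable fun q : X × ℝ => duhamel μ K p φ u q.1 q.2 := by
  refine (measurable_kernelEvolution hK hφ).add ?_
  simp_rw [← lintegral_indicator measurableSet_Ioo]
  refine Measurable.lintegral_prod_right' (f := fun r : (X × ℝ) × ℝ =>
    (Ioo (0 : ℝ) r.1.2).indicator
      (fun s => ∫⁻ y, K r.1.1 y (r.1.2 - s) * u y s ^ p ∂μ) r.2) ?_
  have hS : MeasurableSet {r : (X × ℝ) × ℝ | r.2 ∈ Ioo (0 : ℝ) r.1.2} :=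
    (measurableSet_lt measurable_const measurable_snd).inter
      (measurableSet_lt measurable_snd (by fun_prop))
  exact (measurable_duhamel_integrand hK hu p).indicator hS

lemma duhamel_mono (hp : 0 ≤ p) {u v : X → ℝ → ℝ≥0∞} (h : ∀ y s, 0 < s → u y s ≤ v y s)
    (x : X) (t : ℝ) : duhamel μ K p φ u x t ≤ duhamel μ K p φ v x t := by
  unfold duhamel
  gcongr _ + ?_
  refine setLIntegral_mono' measurableSet_Ioo fun s hs => lintegral_mono fun y => ?_
  have := h y s hs.1
  gcongr

lemma measurable_picard [SFinite μ] (hK : Measurable fun q : X × X × ℝ => K q.1 q.2.1 q.2.2)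
    (hφ : Measurable φ) (n : ℕ) :
    Measurable fun q : X × ℝ => picard μ K p φ n q.1 q.2 := by
  induction n with
  | zero => exact measurable_const
  | succ n ih => exact measurable_duhamel hK hφ ih

lemma picard_le_succ (hp : 0 ≤ p) (n : ℕ) :
    picard μ K p φ n ≤ picard μ K p φ (n + 1) := by
  induction n with
  | zero => exact fun _ _ => zero_le
  | succ n ih => exact fun x t => duhamel_mono hp (fun y s _ => ih y s) x t

lemma picard_le (hp : 0 ≤ p) {v : X → ℝ → ℝ≥0∞}
    (hv : ∀ x t, 0 < t → duhamel μ K p φ v x t ≤ v x t) (n : ℕ) :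
    ∀ x t, 0 < t → picard μ K p φ n x t ≤ v x t := by
  induction n with
  | zero => exact fun _ _ _ => zero_le
  | succ n ih => exact fun x t ht => (duhamel_mono hp ih x t).trans (hv x t ht)

lemma duhamel_iSup [SFinite μ] (hK : Measurable fun q : X × X × ℝ => K q.1 q.2.1 q.2.2)
    (hp : 0 < p) {u : ℕ → X → ℝ → ℝ≥0∞} (hu : ∀ n, Measurable fun q : X × ℝ => u n q.1 q.2)
    (hmono : Monotone u) (x : X) (t : ℝ) :
    duhamel μ K p φ (fun y s => ⨆ n, u n y s) x t = ⨆ n, duhamel μ K p φ (u n) x t := by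
  unfold duhamel
  rw [← ENNReal.add_iSup]
  congr 1
  have hin : ∀ n s, Measurable fun y => K x y (t - s) * u n y s ^ p := fun n s =>
    (hK.comp (f := fun y => (x, y, t - s)) (by fun_prop)).mul
      (((hu n).comp (f := fun y => (y, s)) (by fun_prop)).pow_const p)
  have hmono' : ∀ s, Monotone fun n y => K x y (t - s) * u n y s ^ p := by
    intro s m n hmn y
    have := hmono hmn y s
    dsimp only
    gcongr
  have hpow : ∀ y s, (⨆ n, u n y s) ^ p = ⨆ n, u n y s ^ p := fun y s =>
    (ENNReal.orderIsoRpow p hp).map_iSup _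
  simp_rw [hpow, ENNReal.mul_iSup]
  rw [← lintegral_iSup]
  · refine lintegral_congr fun s => ?_
    exact lintegral_iSup (fun n => hin n s) (hmono' s)
  · intro n
    exact (measurable_duhamel_integrand hK (hu n) p).comp (f := fun s => ((x, t), s))
      (by fun_prop)
  · intro m n hmn s
    exact lintegral_mono (hmono' s hmn)

/-- A supersolution of the Duhamel equation dominates a solution of it. -/
theorem exists_duhamel_eq_of_supersolution [SFinite μ]
    (hK : Measurable fun q : X × X × ℝ => K q.1 q.2.1 q.2.2) (hφ : Measurable φ) (hp : 0 < p)
    {v : X → ℝ → ℝ≥0∞} (hv : ∀ x t, 0 < t → duhamel μ K p φ v x t ≤ v x t) :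
    ∃ u : X → ℝ → ℝ≥0∞, Measurable (fun q : X × ℝ => u q.1 q.2) ∧
      (∀ x t, u x t = duhamel μ K p φ u x t) ∧ ∀ x t, 0 < t → u x t ≤ v x t := by
  have hmono : Monotone (picard μ K p φ) := monotone_nat_of_le_succ (picard_le_succ hp.le)
  refine ⟨fun x t => ⨆ n, picard μ K p φ n x t,
    Measurable.iSup fun n => measurable_picard hK hφ n, fun x t => ?_,
    fun x t ht => iSup_le fun n => picard_le hp.le hv n x t ht⟩
  rw [duhamel_iSup hK hp (measurable_picard hK hφ) hmono]
  refine le_antisymm (iSup_le fun n => ?_) (iSup_le fun n => ?_)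
  · exact le_iSup_of_le n (picard_le_succ hp.le n x t)
  · exact le_iSup_of_le (n + 1) le_rfl

lemma kernelEvolution_kernelEvolution [SFinite μ]
    (hK : Measurable fun q : X × X × ℝ => K q.1 q.2.1 q.2.2)
    (hK2 : ∀ x y s t, 0 < s → s < t → K x y t = ∫⁻ z, K x z (t - s) * K z y s ∂μ)
    (hφ : Measurable φ) (x : X) {s t : ℝ} (hs : 0 < s) (hst : s < t) :
    ∫⁻ y, K x y (t - s) * kernelEvolution μ K φ y s ∂μ = kernelEvolution μ K φ x t := by
  unfold kernelEvolution
  have h1 : ∀ y, Measurable fun z => K y z s * φ z := fun y =>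
    (hK.comp (f := fun z => (y, z, s)) (by fun_prop)).mul hφ
  have h2 : Measurable fun r : X × X => K x r.1 (t - s) * (K r.1 r.2 s * φ r.2) :=
    (hK.comp (f := fun r : X × X => (x, r.1, t - s)) (by fun_prop)).mul
      ((hK.comp (f := fun r : X × X => (r.1, r.2, s)) (by fun_prop)).mul (by fun_prop))
  have h3 : ∀ z, Measurable fun y => K x y (t - s) * K y z s := fun z =>
    (hK.comp (f := fun y => (x, y, t - s)) (by fun_prop)).mul
      (hK.comp (f := fun y => (y, z, s)) (by fun_prop))
  simp_rw [← lintegral_const_mul _ (h1 _)]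
  rw [lintegral_lintegral_swap h2.aemeasurable]
  refine lintegral_congr fun z => ?_
  rw [hK2 x z s t hs hst, ← lintegral_mul_const _ (h3 z)]
  simp_rw [mul_assoc]

lemma lintegral_Ioo_rpow {e t : ℝ} (he : 0 < e) (ht : 0 < t) :
    ∫⁻ s in Ioo (0 : ℝ) t, ENNReal.ofReal (s ^ (e - 1)) = ENNReal.ofReal (t ^ e / e) := by
  have hint : IntegrableOn (fun s : ℝ => s ^ (e - 1)) (Ioc 0 t) :=
    (intervalIntegrable_iff_integrableOn_Ioc_of_le ht.le).1
      (intervalIntegral.intervalIntegrable_rpow' (by linarith))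
  rw [restrict_Ioo_eq_restrict_Ioc, ← ofReal_integral_eq_lintegral_ofReal hint,
    ← intervalIntegral.integral_of_le ht.le, integral_rpow (Or.inl (by linarith))]
  · simp [he.ne']
  · filter_upwards [ae_restrict_mem measurableSet_Ioc] with s hs
    exact rpow_nonneg hs.1.le _

/-- If the evolution of `φ ^ a` decays at the scaling rate with a small constant, then twice its
`a`-th root is a supersolution of the Duhamel equation. -/
theorem duhamel_le_two_mul_rpow_kernelEvolution [SFinite μ]
    (hK : Measurable fun q : X × X × ℝ => K q.1 q.2.1 q.2.2)
    (hK1 : ∀ x t, 0 < t → ∫⁻ y, K x y t ∂μ = 1)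
    (hK2 : ∀ x y s t, 0 < s → s < t → K x y t = ∫⁻ z, K x z (t - s) * K z y s ∂μ)
    (hφ : Measurable φ) {a B : ℝ} (ha : 1 < a) (hap : a < p) (hB : 0 < B)
    (hB' : 2 ^ p * B ^ ((p - 1) / a) ≤ (a - 1) / (p - 1))
    (hdecay : ∀ x t, 0 < t →
      kernelEvolution μ K (fun y => φ y ^ a) x t ≤ ENNReal.ofReal (B * t ^ (-(a / (p - 1)))))
    (x : X) {t : ℝ} (ht : 0 < t) :
    duhamel μ K p φ (fun y s => 2 * kernelEvolution μ K (fun z => φ z ^ a) y s ^ (1 / a)) x t ≤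
      2 * kernelEvolution μ K (fun y => φ y ^ a) x t ^ (1 / a) := by
  set P := kernelEvolution μ K (fun y => φ y ^ a) with hP
  have hp1 : 0 < p - 1 := by linarith
  have hp0 : 0 < p := by linarith
  have ha0 : 0 < a := by linarith
  set e := (a - 1) / (p - 1) with he
  have he0 : 0 < e := div_pos (by linarith) hp1
  have hpa : 0 < p / a - 1 := by rw [sub_pos, lt_div_iff₀ ha0]; linarith
  have hPm : Measurable fun q : X × ℝ => P q.1 q.2 :=
    measurable_kernelEvolution hK (hφ.pow_const a)
  have hPt : ∀ {b c : ℝ}, 0 ≤ b → -(a / (p - 1)) * b = c → ∀ y s, 0 < s →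
      P y s ^ b ≤ ENNReal.ofReal (B ^ b * s ^ c) := by
    rintro b c hb rfl y s hs
    have h0 : 0 ≤ s ^ (-(a / (p - 1))) := rpow_nonneg hs.le _
    rw [rpow_mul hs.le, ← mul_rpow hB.le h0,
      ← ENNReal.ofReal_rpow_of_nonneg (mul_nonneg hB.le h0) hb]
    exact ENNReal.rpow_le_rpow (hdecay y s hs) hb
  have hv : ∀ y s, 0 < s → (2 * P y s ^ (1 / a)) ^ p ≤
      ENNReal.ofReal (2 ^ p * B ^ (p / a - 1)) * ENNReal.ofReal (s ^ (e - 1)) * P y s := by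
    intro y s hs
    have h1 := hPt hpa.le (c := e - 1) (by rw [he]; field_simp; ring) y s hs
    have h2 : (2 : ℝ≥0∞) ^ p = ENNReal.ofReal (2 ^ p) := by
      rw [← ENNReal.ofReal_rpow_of_nonneg (by norm_num) hp0.le, ENNReal.ofReal_ofNat]
    have h3 : P y s ^ (p / a) = P y s ^ (p / a - 1) * P y s := by
      conv_rhs => enter [2]; rw [← ENNReal.rpow_one (P y s)]
      rw [← ENNReal.rpow_add_of_nonneg _ _ hpa.le zero_le_one]
      congr 1; ring
    calc (2 * P y s ^ (1 / a)) ^ p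
        = ENNReal.ofReal (2 ^ p) * (P y s ^ (p / a - 1) * P y s) := by
          rw [ENNReal.mul_rpow_of_nonneg _ _ hp0.le, ← ENNReal.rpow_mul, h2, ← h3]
          congr 2; ring
      _ ≤ ENNReal.ofReal (2 ^ p) * (ENNReal.ofReal (B ^ (p / a - 1) * s ^ (e - 1)) * P y s) := by
          gcongr
      _ = _ := by
          rw [ENNReal.ofReal_mul (by positivity), ENNReal.ofReal_mul (by positivity)]
          ring
  have hJ := kernelEvolution_le_rpow hK hK1 hφ ha.le x ht
  have hPm' : ∀ s, Measurable fun y => K x y (t - s) * P y s := fun s =>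
    (hK.comp (f := fun y => (x, y, t - s)) (by fun_prop)).mul
      (hPm.comp (f := fun y => (y, s)) (by fun_prop))
  have hN : ∫⁻ s in Ioo (0 : ℝ) t, ∫⁻ y, K x y (t - s) * (2 * P y s ^ (1 / a)) ^ p ∂μ ≤
      ENNReal.ofReal (2 ^ p * B ^ (p / a - 1)) * ENNReal.ofReal (t ^ e / e) * P x t := by
    have hmeas : Measurable fun s : ℝ => ENNReal.ofReal (s ^ (e - 1)) := by fun_prop
    rw [← lintegral_Ioo_rpow he0 ht, ← lintegral_const_mul _ hmeas,
      ← lintegral_mul_const _ (by fun_prop)]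
    refine setLIntegral_mono' measurableSet_Ioo fun s hs => ?_
    rw [hP, ← kernelEvolution_kernelEvolution hK hK2 (hφ.pow_const a) x hs.1 hs.2, ← hP,
      ← lintegral_const_mul _ (hPm' s)]
    refine lintegral_mono fun y => ?_
    rw [mul_left_comm]
    gcongr
    exact hv y s hs.1
  have hN' : ENNReal.ofReal (2 ^ p * B ^ (p / a - 1)) * ENNReal.ofReal (t ^ e / e) * P x t ≤
      P x t ^ (1 / a) := by
    have ha1 : 0 ≤ 1 - 1 / a := by
      rw [sub_nonneg, div_le_one ha0]; exact ha.le
    have h1 := hPt ha1 (c := -e) (by rw [he]; field_simp) x t ht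
    have h3 : P x t = P x t ^ (1 - 1 / a) * P x t ^ (1 / a) := by
      rw [← ENNReal.rpow_add_of_nonneg _ _ ha1 (by positivity)]
      simp
    have hte := rpow_pos_of_pos ht e
    have h4 : 2 ^ p * B ^ (p / a - 1) * (t ^ e / e) * (B ^ (1 - 1 / a) * t ^ (-e)) ≤ 1 := by
      have h5 : B ^ ((p - 1) / a) = B ^ (p / a - 1) * B ^ (1 - 1 / a) := by
        rw [← rpow_add hB]; congr 1; ring
      rw [rpow_neg ht.le, show 2 ^ p * B ^ (p / a - 1) * (t ^ e / e) *
        (B ^ (1 - 1 / a) * (t ^ e)⁻¹) = 2 ^ p * (B ^ (p / a - 1) * B ^ (1 - 1 / a)) / e by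
          field_simp, ← h5, div_le_one he0]
      exact hB'
    calc _ ≤ ENNReal.ofReal (2 ^ p * B ^ (p / a - 1)) * ENNReal.ofReal (t ^ e / e) *
          (ENNReal.ofReal (B ^ (1 - 1 / a) * t ^ (-e)) * P x t ^ (1 / a)) := by
          conv_lhs => rw [h3]
          gcongr
      _ = ENNReal.ofReal (2 ^ p * B ^ (p / a - 1) * (t ^ e / e) *
            (B ^ (1 - 1 / a) * t ^ (-e))) * P x t ^ (1 / a) := by
          rw [← mul_assoc, ← ENNReal.ofReal_mul (by positivity),
            ← ENNReal.ofReal_mul (by positivity)]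
      _ ≤ 1 * P x t ^ (1 / a) := by
          gcongr
          exact ENNReal.ofReal_le_one.2 h4
      _ = _ := one_mul _
  rw [two_mul]
  exact add_le_add hJ (hN.trans hN')

/-- A function in weak `L^r`, `r > 1`, is integrable above every positive level. -/
lemma setLIntegral_superlevel_le {f : X → ℝ} (hf : Measurable f) {r D : ℝ}
    (hr : 1 < r) (hD : 0 < D)
    (hfD : ∀ l, 0 < l → μ {x | l < f x} ≤ ENNReal.ofReal (D ^ r * l ^ (-r))) {l : ℝ}
    (hl : 0 < l) :
    ∫⁻ x in {x | l < f x}, ENNReal.ofReal (f x) ∂μ ≤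
      ENNReal.ofReal (r / (r - 1) * D ^ r * l ^ (1 - r)) := by
  have hr1 : 0 < r - 1 := by linarith
  have hS : MeasurableSet {x | l < f x} := measurableSet_lt measurable_const hf
  have hDr := rpow_pos_of_pos hD r
  have hlr := rpow_pos_of_pos hl (1 - r)
  have hlr' : l ^ (-r) * l = l ^ (1 - r) := by
    rw [← rpow_add_one hl.ne']; congr 1; ring
  have hpos : 0 ≤ᵐ[μ.restrict {x | l < f x}] f := by
    filter_upwards [ae_restrict_mem hS] with x hx using hl.le.trans (le_of_lt hx)
  have hlevel : ∀ s, μ.restrict {x | l < f x} {x | s < f x} = μ {x | max s l < f x} := fun s => by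
    rw [Measure.restrict_apply (measurableSet_lt measurable_const hf)]
    congr 1; ext x; simp
  rw [lintegral_eq_lintegral_meas_lt _ hpos hf.aemeasurable]
  simp_rw [hlevel]
  rw [← Ioc_union_Ioi_eq_Ioi hl.le, lintegral_union measurableSet_Ioi Ioc_disjoint_Ioi_same]
  have h1 : ∫⁻ s in Ioc 0 l, μ {x | max s l < f x} ≤ ENNReal.ofReal (D ^ r * l ^ (1 - r)) := by
    calc _ ≤ ∫⁻ s in Ioc 0 l, ENNReal.ofReal (D ^ r * l ^ (-r)) :=
          setLIntegral_mono' measurableSet_Ioc fun s hs => by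
            rw [max_eq_right hs.2]; exact hfD l hl
      _ = _ := by
          rw [setLIntegral_const, Real.volume_Ioc, sub_zero, ← ENNReal.ofReal_mul (by positivity),
            mul_assoc, hlr']
  have h2 : ∫⁻ s in Ioi l, μ {x | max s l < f x} ≤
      ENNReal.ofReal (D ^ r * (l ^ (1 - r) / (r - 1))) := by
    have hint : IntegrableOn (fun s : ℝ => D ^ r * s ^ (-r)) (Ioi l) :=
      (integrableOn_Ioi_rpow_of_lt (by linarith) hl).const_mul _
    calc _ ≤ ∫⁻ s in Ioi l, ENNReal.ofReal (D ^ r * s ^ (-r)) :=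
          setLIntegral_mono' measurableSet_Ioi fun s (hs : l < s) => by
            rw [max_eq_left hs.le]; exact hfD s (hl.trans hs)
      _ = _ := by
          rw [← ofReal_integral_eq_lintegral_ofReal hint, integral_const_mul,
            integral_Ioi_rpow_of_lt (by linarith) hl]
          · congr 2
            rw [show -r + 1 = 1 - r by ring, neg_div, ← div_neg, neg_sub]
          · filter_upwards [ae_restrict_mem measurableSet_Ioi] with s hs
            have : 0 ≤ s ^ (-r) := rpow_nonneg (hl.trans hs).le _
            positivity
  refine (add_le_add h1 h2).trans_eq ?_
  rw [← ENNReal.ofReal_add (by positivity) (by positivity)]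
  congr 1
  field_simp
  ring

lemma kernelEvolution_le_add (hK : Measurable fun q : X × X × ℝ => K q.1 q.2.1 q.2.2)
    (hK1 : ∀ x t, 0 < t → ∫⁻ y, K x y t ∂μ = 1) (f : X → ℝ) (l : ℝ) (x : X) {t : ℝ}
    (ht : 0 < t) :
    kernelEvolution μ K (fun y => ENNReal.ofReal (f y)) x t ≤ ENNReal.ofReal l +
      kernelEvolution μ K ({y | l < f y}.indicator fun y => ENNReal.ofReal (f y)) x t := by
  have hm : Measurable fun y => K x y t := hK.comp (f := fun y => (x, y, t)) (by fun_prop)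
  conv_rhs => enter [1]; rw [← kernelEvolution_const hK1 hK (ENNReal.ofReal l) x ht]
  unfold kernelEvolution
  rw [← lintegral_add_left (hm.mul_const _)]
  refine lintegral_mono fun y => ?_
  rw [← mul_add]
  gcongr
  by_cases hy : l < f y
  · rw [indicator_of_mem (show y ∈ {y | l < f y} from hy)]
    exact le_add_self
  · exact (ENNReal.ofReal_le_ofReal (not_lt.1 hy)).trans le_self_add

/-- The weak `L^r` to `L^∞` smoothing estimate. -/
lemma kernelEvolution_le_of_weak (hK : Measurable fun q : X × X × ℝ => K q.1 q.2.1 q.2.2)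
    (hK1 : ∀ x t, 0 < t → ∫⁻ y, K x y t ∂μ = 1) {C₀ θ : ℝ} (hC₀ : 0 < C₀)
    (hKC : ∀ x y t, 0 < t → K x y t ≤ ENNReal.ofReal (C₀ * t ^ (-θ)))
    {f : X → ℝ} (hf : Measurable f) {r D : ℝ} (hr : 1 < r) (hD : 0 < D)
    (hfD : ∀ l, 0 < l → μ {x | l < f x} ≤ ENNReal.ofReal (D ^ r * l ^ (-r)))
    (x : X) {t : ℝ} (ht : 0 < t) :
    kernelEvolution μ K (fun y => ENNReal.ofReal (f y)) x t ≤
      ENNReal.ofReal ((1 + C₀ * (r / (r - 1))) * D * t ^ (-(θ / r))) := by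
  have hr1 : 0 < r - 1 := by linarith
  have htθ := rpow_pos_of_pos ht (-θ)
  have htr := rpow_pos_of_pos ht (-(θ / r))
  set l := D * t ^ (-(θ / r)) with hl_def
  have hl : 0 < l := by positivity
  have hS : MeasurableSet {x | l < f x} := measurableSet_lt measurable_const hf
  refine (kernelEvolution_le_add hK hK1 f l x ht).trans ?_
  have h1 : kernelEvolution μ K ({y | l < f y}.indicator fun y => ENNReal.ofReal (f y)) x t ≤
      ENNReal.ofReal (C₀ * t ^ (-θ)) *
        ENNReal.ofReal (r / (r - 1) * D ^ r * l ^ (1 - r)) := by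
    refine le_trans ?_ (mul_le_mul_right (setLIntegral_superlevel_le hf hr hD hfD hl) _)
    rw [← lintegral_indicator hS,
      ← lintegral_const_mul _ ((hf.ennreal_ofReal).indicator hS)]
    refine lintegral_mono fun y => ?_
    have := hKC x y t ht
    gcongr
  refine (add_le_add le_rfl h1).trans_eq ?_
  have hlr := rpow_pos_of_pos hl (1 - r)
  rw [← ENNReal.ofReal_mul (by positivity), ← ENNReal.ofReal_add (by positivity) (by positivity)]
  congr 1
  have h2 : t ^ (-θ) * (D ^ r * l ^ (1 - r)) = D * t ^ (-(θ / r)) := by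
    rw [hl_def, mul_rpow hD.le htr.le, ← rpow_mul ht.le, ← mul_assoc (D ^ r), ← rpow_add hD,
      mul_left_comm, ← rpow_add ht]
    rw [show r + (1 - r) = 1 by ring, rpow_one]
    congr 2
    field_simp
    ring
  calc l + C₀ * t ^ (-θ) * (r / (r - 1) * D ^ r * l ^ (1 - r))
      = l + C₀ * (r / (r - 1)) * (t ^ (-θ) * (D ^ r * l ^ (1 - r))) := by ring
    _ = _ := by rw [h2, hl_def]; ring

/-- The evolution is bounded on weak `L^r`. -/
lemma measure_lt_kernelEvolution_le [SFinite μ]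
    (hK : Measurable fun q : X × X × ℝ => K q.1 q.2.1 q.2.2)
    (hK1 : ∀ x t, 0 < t → ∫⁻ y, K x y t ∂μ = 1) (hK1' : ∀ y t, 0 < t → ∫⁻ x, K x y t ∂μ = 1)
    {f : X → ℝ} (hf : Measurable f) {r D : ℝ} (hr : 1 < r) (hD : 0 < D)
    (hfD : ∀ l, 0 < l → μ {x | l < f x} ≤ ENNReal.ofReal (D ^ r * l ^ (-r)))
    {t : ℝ} (ht : 0 < t) {l : ℝ} (hl : 0 < l) :
    μ {x | ENNReal.ofReal (2 * l) < kernelEvolution μ K (fun y => ENNReal.ofReal (f y)) x t} ≤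
      ENNReal.ofReal (r / (r - 1) * D ^ r * l ^ (-r)) := by
  have hS : MeasurableSet {x | l < f x} := measurableSet_lt measurable_const hf
  have hl' := ENNReal.ofReal_pos.2 hl
  set g : X → ℝ≥0∞ := {y | l < f y}.indicator fun y => ENNReal.ofReal (f y) with hg
  have hgm : Measurable g := hf.ennreal_ofReal.indicator hS
  have hsub : {x | ENNReal.ofReal (2 * l) <
      kernelEvolution μ K (fun y => ENNReal.ofReal (f y)) x t} ⊆
      {x | ENNReal.ofReal l ≤ kernelEvolution μ K g x t} := by
    intro x hx
    by_contra hlt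
    rw [mem_ofPred_eq, not_le] at hlt
    refine absurd (hx.trans_le (kernelEvolution_le_add hK hK1 f l x ht)) (not_lt.2 ?_)
    rw [two_mul, ENNReal.ofReal_add hl.le hl.le]
    gcongr
  have hmass : ∫⁻ x, kernelEvolution μ K g x t ∂μ ≤
      ENNReal.ofReal (r / (r - 1) * D ^ r * l ^ (1 - r)) := by
    have hm : Measurable fun q : X × X => K q.1 q.2 t * g q.2 :=
      (hK.comp (f := fun q : X × X => (q.1, q.2, t)) (by fun_prop)).mul
        (hgm.comp measurable_snd)
    have hm' : ∀ y, Measurable fun x => K x y t := fun y =>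
      hK.comp (f := fun x => (x, y, t)) (by fun_prop)
    unfold kernelEvolution
    rw [lintegral_lintegral_swap hm.aemeasurable]
    simp_rw [lintegral_mul_const _ (hm' _), hK1' _ t ht, one_mul]
    rw [hg, lintegral_indicator hS]
    exact setLIntegral_superlevel_le hf hr hD hfD hl
  have hem : Measurable fun x => kernelEvolution μ K g x t :=
    (measurable_kernelEvolution hK hgm).comp (f := fun x => (x, t)) (by fun_prop)
  refine (measure_mono hsub).trans ((meas_ge_le_lintegral_div hem.aemeasurable hl'.ne'
    ENNReal.ofReal_ne_top).trans ((ENNReal.div_le_div_right hmass _).trans_eq ?_))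
  rw [← ENNReal.ofReal_div_of_pos hl, show 1 - r = -r + 1 by ring, rpow_add_one hl.ne']
  congr 1
  field_simp

end Kernel

lemma measure_lt_le_of_weakNorm_lt {N : ℕ} {rs δ : ℝ} (hrs : 0 < rs) (hδ : 0 < δ) {f : E N → ℝ}
    (hf : weakNorm N rs f < ENNReal.ofReal δ) {l : ℝ} (hl : 0 < l) :
    volume {x | l < f x} ≤ ENNReal.ofReal ((δ / l) ^ rs) := by
  have h1 : ENNReal.ofReal l * volume {x | l < |f x|} ^ (1 / rs) ≤ ENNReal.ofReal δ :=
    (le_iSup₂ (f := fun (l : ℝ) (_ : 0 < l) =>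
      ENNReal.ofReal l * volume {x | l < |f x|} ^ (1 / rs)) l hl).trans hf.le
  have h2 : volume {x | l < |f x|} ^ (1 / rs) ≤ ENNReal.ofReal (δ / l) := by
    rw [ENNReal.ofReal_div_of_pos hl, ENNReal.le_div_iff_mul_le
      (Or.inl (ENNReal.ofReal_pos.2 hl).ne') (Or.inl ENNReal.ofReal_ne_top), mul_comm]
    exact h1
  rw [← ENNReal.ofReal_rpow_of_nonneg (by positivity) hrs.le]
  rw [one_div, ENNReal.rpow_inv_le_iff hrs] at h2
  exact (measure_mono fun x (hx : l < f x) => hx.trans_le (le_abs_self _)).trans h2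

/-- Interpolation between weak `L^r` and `L^∞`. -/
lemma weakNorm_le_of_bound {N : ℕ} {r q G S : ℝ} (hr : 0 < r) (hrq : r ≤ q) (hG : 0 ≤ G)
    {f : E N → ℝ} (hfS : ∀ x, |f x| ≤ S)
    (hf : ∀ l, 0 < l → volume {x | l < |f x|} ≤ ENNReal.ofReal (G * l ^ (-r))) :
    weakNorm N q f ≤ ENNReal.ofReal (G ^ (1 / q) * S ^ (1 - r / q)) := by
  have hq : 0 < q := hr.trans_le hrq
  refine iSup₂_le fun l hl => ?_
  rcases le_or_gt S l with hSl | hSl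
  · have : {x | l < |f x|} = ∅ :=
      eq_empty_of_forall_notMem fun x hx => absurd ((hfS x).trans hSl) (not_le.2 hx)
    rw [this, measure_empty, ENNReal.zero_rpow_of_pos (by positivity), mul_zero]
    exact zero_le
  · have hlr := rpow_pos_of_pos hl (-r)
    calc _ ≤ ENNReal.ofReal l * ENNReal.ofReal (G * l ^ (-r)) ^ (1 / q) := by
          gcongr
          exact hf l hl
      _ = ENNReal.ofReal (G ^ (1 / q) * l ^ (1 - r / q)) := by
          rw [ENNReal.ofReal_rpow_of_nonneg (by positivity) (by positivity),
            ← ENNReal.ofReal_mul hl.le, mul_rpow hG hlr.le, ← rpow_mul hl.le,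
            show 1 - r / q = 1 + -r * (1 / q) by ring, rpow_add hl, rpow_one]
          congr 1
          ring
      _ ≤ _ := by
          have : 0 ≤ 1 - r / q := by rw [sub_nonneg, div_le_one hq]; exact hrq
          gcongr

lemma isMildSolution_toReal {N : ℕ} {p : ℝ} (hp : 0 < p) {Γ : E N → E N → ℝ → ℝ}
    (hΓmeas : Measurable fun q : E N × E N × ℝ => Γ q.1 q.2.1 q.2.2)
    (hΓnonneg : ∀ x y : E N, ∀ t : ℝ, 0 < t → 0 ≤ Γ x y t)
    {φ : E N → ℝ} (hφ : Measurable φ) (hφ0 : ∀ x, 0 ≤ φ x) {u : E N → ℝ → ℝ≥0∞}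
    (hu : Measurable fun q : E N × ℝ => u q.1 q.2) {S : ℝ}
    (huS : ∀ x t, 0 < t → u x t ≤ ENNReal.ofReal S)
    (hduh : ∀ x t, 0 < t → u x t = duhamel volume (fun x y t => ENNReal.ofReal (Γ x y t)) p
      (fun y => ENNReal.ofReal (φ y)) u x t) :
    IsMildSolution N p Γ φ ⊤ fun x t => (u x t).toReal := by
  have hfin : ∀ x t, 0 < t → u x t ≠ ⊤ := fun x t ht =>
    ((huS x t ht).trans_lt ENNReal.ofReal_lt_top).ne
  refine ⟨hu.ennreal_toReal, fun _ _ => ENNReal.toReal_nonneg, ⟨max S 0, fun t ht _ =>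
    .of_forall fun x => ?_⟩, fun t ht _ => .of_forall fun x => ?_⟩
  · exact (ENNReal.toReal_mono ENNReal.ofReal_ne_top (huS x t ht)).trans_eq
      ENNReal.toReal_ofReal'
  have hd := hduh x t ht
  have hdfin := hd ▸ hfin x t ht
  rw [duhamel, ENNReal.add_ne_top] at hdfin
  obtain ⟨hfin1, hfin2⟩ := hdfin
  have hm1 : Measurable fun y => Γ x y t * φ y :=
    (hΓmeas.comp (f := fun y => (x, y, t)) (by fun_prop)).mul hφ
  have hpos1 : 0 ≤ᵐ[volume] fun y => Γ x y t * φ y :=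
    .of_forall fun y => mul_nonneg (hΓnonneg x y t ht) (hφ0 y)
  have heq1 : ∫⁻ y, ENNReal.ofReal (Γ x y t * φ y) = kernelEvolution volume
      (fun x y t => ENNReal.ofReal (Γ x y t)) (fun y => ENNReal.ofReal (φ y)) x t :=
    lintegral_congr fun y => ENNReal.ofReal_mul (hΓnonneg x y t ht)
  have hm2 : Measurable fun q : E N × ℝ => Γ x q.1 (t - q.2) :=
    hΓmeas.comp (f := fun q : E N × ℝ => (x, q.1, t - q.2)) (by fun_prop)
  have hm3 : Measurable fun q : E N × ℝ => Γ x q.1 (t - q.2) * (u q.1 q.2).toReal ^ p :=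
    hm2.mul (hu.ennreal_toReal.pow_const p)
  have hmem : ∀ᵐ q : E N × ℝ ∂(volume.prod (volume.restrict (Ioo (0 : ℝ) t))),
      q.2 ∈ Ioo (0 : ℝ) t :=
    Measure.quasiMeasurePreserving_snd.ae (ae_restrict_mem measurableSet_Ioo)
  have hpos2 : 0 ≤ᵐ[volume.prod (volume.restrict (Ioo (0 : ℝ) t))]
      fun q : E N × ℝ => Γ x q.1 (t - q.2) * (u q.1 q.2).toReal ^ p := by
    filter_upwards [hmem] with q hq
    exact mul_nonneg (hΓnonneg _ _ _ (sub_pos.2 hq.2)) (by positivity)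
  have heq2 : ∫⁻ q : E N × ℝ, ENNReal.ofReal (Γ x q.1 (t - q.2) * (u q.1 q.2).toReal ^ p)
        ∂(volume.prod (volume.restrict (Ioo (0 : ℝ) t))) =
      ∫⁻ s in Ioo (0 : ℝ) t, ∫⁻ y, ENNReal.ofReal (Γ x y (t - s)) * u y s ^ p := by
    rw [← lintegral_prod_symm (fun q : E N × ℝ =>
      ENNReal.ofReal (Γ x q.1 (t - q.2)) * u q.1 q.2 ^ p)
      (hm2.ennreal_ofReal.mul (hu.pow_const p)).aemeasurable]
    refine lintegral_congr_ae ?_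
    filter_upwards [hmem] with q hq
    rw [ENNReal.ofReal_mul (hΓnonneg _ _ _ (sub_pos.2 hq.2)),
      ← ENNReal.ofReal_rpow_of_nonneg ENNReal.toReal_nonneg hp.le,
      ENNReal.ofReal_toReal (hfin _ _ hq.1)]
  have hint2 : Integrable (fun q : E N × ℝ => Γ x q.1 (t - q.2) * (u q.1 q.2).toReal ^ p)
      (volume.prod (volume.restrict (Ioo (0 : ℝ) t))) :=
    ⟨hm3.aestronglyMeasurable, (hasFiniteIntegral_iff_ofReal hpos2).2
      (heq2 ▸ hfin2.lt_top)⟩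
  refine ⟨⟨hm1.aestronglyMeasurable, (hasFiniteIntegral_iff_ofReal hpos1).2
    (heq1 ▸ hfin1.lt_top)⟩, hint2, ?_⟩
  rw [← integral_prod_symm _ hint2, integral_eq_lintegral_of_nonneg_ae hpos1
    hm1.aestronglyMeasurable, integral_eq_lintegral_of_nonneg_ae hpos2 hm3.aestronglyMeasurable,
    heq1, heq2, ← ENNReal.toReal_add hfin1 hfin2]
  exact congrArg ENNReal.toReal hd

lemma lintegral_ofReal_eq_one {X : Type*} [MeasurableSpace X] {μ : Measure X} {f : X → ℝ}
    (hf : ∀ x, 0 ≤ f x) (h : ∫ x, f x ∂μ = 1) : ∫⁻ x, ENNReal.ofReal (f x) ∂μ = 1 := by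
  rw [← ofReal_integral_eq_lintegral_ofReal
    (Integrable.of_integral_ne_zero (by rw [h]; exact one_ne_zero)) (.of_forall hf), h,
    ENNReal.ofReal_one]

/-- The semigroup property for Bochner integrals gives the one for lower Lebesgue integrals when
one of the factors is bounded and the other one integrable. -/
lemma ofReal_integral_mul_eq_lintegral {X : Type*} [MeasurableSpace X] {μ : Measure X}
    {f g : X → ℝ} (hf : ∀ x, 0 ≤ f x) (hg : ∀ x, 0 ≤ g x) (hfm : Measurable f) {C : ℝ}
    (hfC : ∀ x, f x ≤ C) (hgi : Integrable g μ) :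
    ENNReal.ofReal (∫ x, f x * g x ∂μ) =
      ∫⁻ x, ENNReal.ofReal (f x) * ENNReal.ofReal (g x) ∂μ := by
  rw [ofReal_integral_eq_lintegral_ofReal _ (.of_forall fun x => mul_nonneg (hf x) (hg x))]
  · exact lintegral_congr fun x => ENNReal.ofReal_mul (hf x)
  · exact hgi.bdd_mul hfm.aestronglyMeasurable (.of_forall fun x => by
      rw [norm_of_nonneg (hf x)]; exact hfC x)

lemma rpow_neg_le_two_div_one_add {k t : ℝ} (hk : 0 ≤ k) (ht : 1 ≤ t) :
    t ^ (-k) ≤ (2 / (1 + t)) ^ k := by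
  have h0 : 0 < t := by linarith
  rw [rpow_neg h0.le, ← inv_rpow h0.le]
  refine rpow_le_rpow (by positivity) ?_ hk
  rw [inv_eq_one_div, div_le_div_iff₀ h0 (by linarith)]
  linarith

/-- Theorem 1.4(i): global existence for small data in weak `L^{r_*}`, for any
nonnegative kernel satisfying (K1), (K2) and the upper Gaussian-type bound,
with the decay estimate in weak `L^q` norms for `r_* ≤ q ≤ ∞`. -/
theorem global_existence_weakLp_radial_weight
    (N : ℕ) (hN : 1 ≤ N) (b : ℝ) (hb1 : -(N : ℝ) < b) (hb2 : b < 1)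
    (p : ℝ) (hp : 1 + (2 - b) / N < p)
    (rs : ℝ) (hrs : rs = N * (p - 1) / (2 - b))
    (Γ : E N → E N → ℝ → ℝ)
    (hΓmeas : Measurable (fun q : E N × E N × ℝ => Γ q.1 q.2.1 q.2.2))
    (hΓnonneg : ∀ x y : E N, ∀ t : ℝ, 0 < t → 0 ≤ Γ x y t)
    (hK1x : ∀ y : E N, ∀ t : ℝ, 0 < t → ∫ x : E N, Γ x y t = 1)
    (hK1y : ∀ x : E N, ∀ t : ℝ, 0 < t → ∫ y : E N, Γ x y t = 1)
    (hK2 : ∀ x y : E N, ∀ s t : ℝ, 0 < s → s < t →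
      Γ x y t = ∫ ξ : E N, Γ x ξ (t - s) * Γ ξ y s)
    (hupp : ∃ C₀ c₀ : ℝ, 0 < C₀ ∧ 0 < c₀ ∧ ∀ x y : E N, ∀ t : ℝ, 0 < t →
      Γ x y t ≤ C₀ * t ^ (-(N : ℝ) / (2 - b)) *
        Real.exp (-c₀ * (‖x - y‖ ^ (2 - b) / t) ^ (1 / (1 - b)))) :
    ∃ δ : ℝ, 0 < δ ∧ ∀ φ : E N → ℝ, Measurable φ → (∀ x, 0 ≤ φ x) →
      eLpNorm φ ⊤ volume ≠ ⊤ → weakNorm N rs φ < ENNReal.ofReal δ →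
      ∃ u : E N → ℝ → ℝ, IsMildSolution N p Γ φ ⊤ u ∧
        (∀ q : ℝ, rs ≤ q → ∃ C : ℝ≥0∞, C ≠ ⊤ ∧ ∀ t : ℝ, 0 < t →
          ENNReal.ofReal ((1 + t) ^ ((N : ℝ) / (2 - b) * (1 / rs - 1 / q))) *
            weakNorm N q (fun x => u x t) ≤ C) ∧
        (∃ C : ℝ≥0∞, C ≠ ⊤ ∧ ∀ t : ℝ, 0 < t →
          ENNReal.ofReal ((1 + t) ^ ((N : ℝ) / (2 - b) * (1 / rs))) *
            eLpNorm (fun x => u x t) ⊤ volume ≤ C) := by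
  have hNpos : (0 : ℝ) < N := by exact_mod_cast hN
  have h2b : 0 < 2 - b := by linarith
  have hp1 : 0 < p - 1 := by
    have : 0 < (2 - b) / N := by positivity
    linarith
  have hrs1 : 1 < rs := by
    rw [hrs, one_lt_div h2b]
    have : (2 - b) / N < p - 1 := by linarith
    rwa [div_lt_iff₀ hNpos, mul_comm] at this
  have hrs0 : 0 < rs := by linarith
  obtain ⟨C₀, c₀, hC₀, hc₀, hΓle⟩ := hupp
  set θ := (N : ℝ) / (2 - b) with hθ
  have hθrs : θ / rs = 1 / (p - 1) := by rw [hθ, hrs]; field_simp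
  have hΓC : ∀ x y : E N, ∀ t : ℝ, 0 < t → Γ x y t ≤ C₀ * t ^ (-θ) := by
    intro x y t ht
    refine (hΓle x y t ht).trans ?_
    rw [neg_div]
    refine mul_le_of_le_one_right (by positivity) (exp_le_one_iff.2 ?_)
    rw [neg_mul, neg_nonpos]
    positivity
  set K : E N → E N → ℝ → ℝ≥0∞ := fun x y t => ENNReal.ofReal (Γ x y t) with hKdef
  have hK : Measurable fun q : E N × E N × ℝ => K q.1 q.2.1 q.2.2 := hΓmeas.ennreal_ofReal
  have hK1 : ∀ x t, 0 < t → ∫⁻ y, K x y t = 1 := fun x t ht =>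
    lintegral_ofReal_eq_one (fun y => hΓnonneg x y t ht) (hK1y x t ht)
  have hK1' : ∀ y t, 0 < t → ∫⁻ x, K x y t = 1 := fun y t ht =>
    lintegral_ofReal_eq_one (fun x => hΓnonneg x y t ht) (hK1x y t ht)
  have hK2' : ∀ x y s t, 0 < s → s < t → K x y t = ∫⁻ z, K x z (t - s) * K z y s := by
    intro x y s t hs hst
    have hts := sub_pos.2 hst
    simp only [hKdef]
    rw [hK2 x y s t hs hst]
    exact ofReal_integral_mul_eq_lintegral (fun z => hΓnonneg _ _ _ hts)
      (fun z => hΓnonneg _ _ _ hs)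
      (hΓmeas.comp (f := fun z => (x, z, t - s)) (by fun_prop)) (fun z => hΓC _ _ _ hts)
      (Integrable.of_integral_ne_zero (by rw [hK1x y s hs]; exact one_ne_zero))
  have hKC : ∀ x y t, 0 < t → K x y t ≤ ENNReal.ofReal (C₀ * t ^ (-θ)) := fun x y t ht =>
    ENNReal.ofReal_le_ofReal (hΓC x y t ht)
  obtain ⟨a, ha, hap'⟩ := exists_between (lt_min (by linarith : 1 < p) hrs1)
  obtain ⟨hap, hars⟩ := lt_min_iff.1 hap'
  have ha0 : 0 < a := by linarith
  set r := rs / a with hr_def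
  have hr : 1 < r := (one_lt_div ha0).2 hars
  have hr1 : 0 < r - 1 := by linarith
  have har : a * r = rs := by rw [hr_def]; field_simp
  have hθr : θ / r = a / (p - 1) := by
    rw [hr_def, div_div_eq_mul_div, mul_comm, mul_div_assoc, hθrs, mul_one_div]
  set C₁ := 1 + C₀ * (r / (r - 1)) with hC₁
  have hC₁0 : 0 < C₁ := by positivity
  set e := (a - 1) / (p - 1) with he
  have he0 : 0 < e := div_pos (by linarith) hp1
  set B := (e / 2 ^ p) ^ (a / (p - 1)) with hB
  have hB0 : 0 < B := by positivity
  have hBe : 2 ^ p * B ^ ((p - 1) / a) ≤ e := by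
    rw [hB, ← rpow_mul (by positivity), show a / (p - 1) * ((p - 1) / a) = 1 by field_simp,
      rpow_one]
    exact le_of_eq (by field_simp)
  set D := B / C₁ with hD
  have hD0 : 0 < D := by positivity
  refine ⟨D ^ (1 / a), by positivity, fun φ hφ hφ0 hφtop hφδ => ?_⟩
  -- the auxiliary datum `φ ^ a` lies in weak `L^r` with norm at most `D`
  have hfD : ∀ l, 0 < l → volume {x | l < φ x ^ a} ≤ ENNReal.ofReal (D ^ r * l ^ (-r)) := by
    intro l hl
    have hset : {x | l < φ x ^ a} = {x | l ^ (1 / a) < φ x} := by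
      ext x
      simp only [mem_ofPred_eq]
      rw [one_div, rpow_inv_lt_iff_of_pos hl.le (hφ0 x) ha0]
    rw [hset]
    refine (measure_lt_le_of_weakNorm_lt hrs0 (by positivity) hφδ
      (rpow_pos_of_pos hl _)).trans_eq ?_
    rw [← div_rpow hD0.le hl.le, ← rpow_mul (by positivity), ← har,
      show 1 / a * (a * r) = r by field_simp, div_rpow hD0.le hl.le, rpow_neg hl.le,
      div_eq_mul_inv]
  have hfm : Measurable fun x => φ x ^ a := hφ.pow_const a
  set ψ : E N → ℝ≥0∞ := fun y => ENNReal.ofReal (φ y) with hψ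
  have hψm : Measurable ψ := hφ.ennreal_ofReal
  have hψa : (fun y => ENNReal.ofReal (φ y ^ a)) = fun y => ψ y ^ a :=
    funext fun y => (ENNReal.ofReal_rpow_of_nonneg (hφ0 y) ha0.le).symm
  set P := kernelEvolution volume K (fun y => ψ y ^ a) with hP
  have hdecay : ∀ x t, 0 < t → P x t ≤ ENNReal.ofReal (B * t ^ (-(a / (p - 1)))) := by
    intro x t ht
    have h := kernelEvolution_le_of_weak hK hK1 hC₀ hKC hfm hr hD0 hfD x ht
    rwa [hψa, ← hC₁, hθr, hD, mul_div_cancel₀ _ hC₁0.ne'] at h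
  obtain ⟨u, hum, hueq, hule⟩ := exists_duhamel_eq_of_supersolution hK hψm (by linarith)
    (fun x t ht => duhamel_le_two_mul_rpow_kernelEvolution hK hK1 hK2' hψm ha hap hB0 hBe hdecay
      x ht)
  -- sup bound
  set A := (eLpNorm φ ⊤ volume).toReal with hA
  have hφA : ∀ᵐ y : E N, φ y ≤ A := by
    rw [eLpNorm_exponent_top] at hφtop hA
    filter_upwards [enorm_ae_le_eLpNormEssSup φ volume] with y hy
    have := ENNReal.toReal_mono hφtop hy
    rwa [toReal_enorm, norm_of_nonneg (hφ0 y)] at this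
  have hPA : ∀ x t, 0 < t → P x t ≤ ENNReal.ofReal (A ^ a) := by
    intro x t ht
    rw [← kernelEvolution_const hK1 hK (ENNReal.ofReal (A ^ a)) x ht, hP, ← hψa]
    refine kernelEvolution_mono ?_ x t
    filter_upwards [hφA] with y hy
    exact ENNReal.ofReal_le_ofReal (rpow_le_rpow (hφ0 y) hy ha0.le)
  set m := max (A ^ a) B with hm
  have hm0 : 0 < m := lt_max_of_lt_right hB0
  have hκ : 0 < a / (p - 1) := by positivity
  have hPm : ∀ x t, 0 < t → P x t ≤ ENNReal.ofReal (m * (2 / (1 + t)) ^ (a / (p - 1))) := by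
    intro x t ht
    rcases le_total t 1 with h | h
    · refine (hPA x t ht).trans (ENNReal.ofReal_le_ofReal ((le_max_left _ B).trans ?_))
      refine le_mul_of_one_le_right hm0.le (one_le_rpow ?_ hκ.le)
      rw [one_le_div (by linarith)]
      linarith
    · refine (hdecay x t ht).trans (ENNReal.ofReal_le_ofReal ?_)
      exact mul_le_mul (le_max_right _ _) (rpow_neg_le_two_div_one_add hκ.le h) (by positivity)
        hm0.le
  set M := 2 * (m ^ (1 / a) * 2 ^ (1 / (p - 1))) with hM
  have hM0 : 0 < M := by positivity
  have huM : ∀ x t, 0 < t → u x t ≤ ENNReal.ofReal (M * (1 + t) ^ (-(1 / (p - 1)))) := by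
    intro x t ht
    have h1t : 0 < 1 + t := by linarith
    have h0 : 0 ≤ (2 / (1 + t)) ^ (a / (p - 1)) := by positivity
    calc u x t ≤ 2 * P x t ^ (1 / a) := hule x t ht
      _ ≤ 2 * ENNReal.ofReal (m * (2 / (1 + t)) ^ (a / (p - 1))) ^ (1 / a) := by
          gcongr
          exact hPm x t ht
      _ = _ := by
          rw [ENNReal.ofReal_rpow_of_nonneg (by positivity) (by positivity),
            ← ENNReal.ofReal_ofNat 2, ← ENNReal.ofReal_mul (by norm_num),
            mul_rpow hm0.le h0, ← rpow_mul (by positivity),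
            show a / (p - 1) * (1 / a) = 1 / (p - 1) by field_simp,
            div_rpow (by norm_num) h1t.le, rpow_neg h1t.le, hM]
          congr 1
          ring
  have huM' : ∀ x t, 0 < t → |(u x t).toReal| ≤ M * (1 + t) ^ (-(1 / (p - 1))) := by
    intro x t ht
    rw [abs_of_nonneg ENNReal.toReal_nonneg]
    exact ENNReal.toReal_le_of_le_ofReal (by positivity) (huM x t ht)
  -- weak bound
  set G := r / (r - 1) * D ^ r * (2 ^ r * 2 ^ rs) with hG
  have hG0 : 0 < G := by positivity
  have huG : ∀ t, 0 < t → ∀ l, 0 < l →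
      volume {x | l < |(u x t).toReal|} ≤ ENNReal.ofReal (G * l ^ (-rs)) := by
    intro t ht l hl
    have hsub : {x | l < |(u x t).toReal|} ⊆
        {x | ENNReal.ofReal (2 * ((l / 2) ^ a / 2)) < P x t} := by
      intro x (hx : l < |(u x t).toReal|)
      rw [abs_of_nonneg ENNReal.toReal_nonneg] at hx
      have h1 : ENNReal.ofReal l < 2 * P x t ^ (1 / a) :=
        ((ENNReal.ofReal_lt_iff_lt_toReal hl.le
          ((huM x t ht).trans_lt ENNReal.ofReal_lt_top).ne).2 hx).trans_le (hule x t ht)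
      show ENNReal.ofReal (2 * ((l / 2) ^ a / 2)) < P x t
      rw [mul_div_cancel₀ _ two_ne_zero, ← ENNReal.ofReal_rpow_of_nonneg (by positivity) ha0.le,
        ← ENNReal.lt_rpow_inv_iff ha0, ← one_div, ENNReal.ofReal_div_of_pos two_pos,
        ENNReal.ofReal_ofNat]
      exact ENNReal.div_lt_of_lt_mul' h1
    have h2 := measure_lt_kernelEvolution_le hK hK1 hK1' hfm hr hD0 hfD ht
      (l := (l / 2) ^ a / 2) (by positivity)
    rw [hψa] at h2
    refine (measure_mono hsub).trans (h2.trans_eq ?_)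
    rw [div_rpow (by positivity) two_pos.le, ← rpow_mul (by positivity), mul_neg, har,
      div_rpow hl.le two_pos.le, rpow_neg two_pos.le, rpow_neg two_pos.le, hG]
    congr 1
    field_simp
  have hts : ∀ {t : ℝ}, 0 < t → (1 + t) ^ (-(1 / (p - 1))) ≤ 1 := fun ht =>
    rpow_le_one_of_one_le_of_nonpos (by linarith) (by rw [neg_nonpos]; positivity)
  refine ⟨fun x t => (u x t).toReal, isMildSolution_toReal (by linarith) hΓmeas hΓnonneg hφ hφ0
    hum (S := M) (fun x t ht => (huM x t ht).trans (ENNReal.ofReal_le_ofReal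
      (mul_le_of_le_one_right hM0.le (hts ht)))) (fun x t _ => hueq x t), fun q hq => ?_, ?_⟩
  · refine ⟨ENNReal.ofReal (G ^ (1 / q) * M ^ (1 - rs / q)), ENNReal.ofReal_ne_top,
      fun t ht => ?_⟩
    have h1t : 0 < 1 + t := by linarith
    have hq0 : 0 < q := hrs0.trans_le hq
    refine (mul_le_mul_right (weakNorm_le_of_bound hrs0 hq hG0.le (fun x => huM' x t ht)
      (huG t ht)) _).trans_eq ?_
    rw [← ENNReal.ofReal_mul (by positivity), mul_rpow hM0.le (by positivity), ← rpow_mul h1t.le,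
      show -(1 / (p - 1)) * (1 - rs / q) = -(θ * (1 / rs - 1 / q)) by
        rw [← hθrs]; field_simp,
      rpow_neg h1t.le]
    congr 1
    field_simp
  · refine ⟨ENNReal.ofReal M, ENNReal.ofReal_ne_top, fun t ht => ?_⟩
    have h1t : 0 < 1 + t := by linarith
    have hsup : eLpNorm (fun x => (u x t).toReal) ⊤ volume ≤
        ENNReal.ofReal (M * (1 + t) ^ (-(1 / (p - 1)))) := by
      rw [eLpNorm_exponent_top]
      exact eLpNormEssSup_le_of_ae_bound (.of_forall fun x => huM' x t ht)
    refine (mul_le_mul_right hsup _).trans_eq ?_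
    rw [← ENNReal.ofReal_mul (by positivity), mul_one_div, hθrs, rpow_neg h1t.le]
    congr 1
    field_simp
end
end

section
/- Let N ≥ 1 and let a be a real number with 0 ≤ a < 1 and aN < 2. Then there exists a constant C > 0 such that for every x ∈ ℝ^N and every r > 0, h_x(r) := (∫_{B_r(x)} |y₁|^{−aN/2} dy)^{2/N} ≤ C r^{2−a}, where y₁ denotes the first coordinate of y and B_r(x) is the open Euclidean ball of radius r centered at x. -/
open MeasureTheory Real Set
open scoped ENNReal

lemma intervalIntegrable_abs_rpow {s : ℝ} (hs : -1 < s) (a b : ℝ) :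
    IntervalIntegrable (fun t : ℝ => |t| ^ s) volume a b := by
  refine intervalIntegrable_of_even (fun x => by simp) (fun x hx => ?_)
  refine (intervalIntegral.intervalIntegrable_rpow' hs).congr fun t ht => ?_
  rw [uIoc_of_le hx.le] at ht
  simp [abs_of_pos ht.1]

lemma integrableOn_Icc_abs_rpow {s : ℝ} (hs : -1 < s) (a b : ℝ) :
    IntegrableOn (fun t : ℝ => |t| ^ s) (Icc a b) := by
  rcases le_total a b with hab | hab
  · exact (intervalIntegrable_iff_integrableOn_Icc_of_le hab).1 (intervalIntegrable_abs_rpow hs a b)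
  · exact (integrableOn_singleton (by simp) (by simp)).mono_set (t := {a}) fun x hx => by
      exact le_antisymm (hx.2.trans hab) hx.1

lemma setIntegral_Icc_abs_rpow {s : ℝ} (hs : -1 < s) {r : ℝ} (hr : 0 < r) :
    ∫ t in Icc (-r) r, |t| ^ s = 2 / (s + 1) * r ^ (s + 1) := by
  have h1 : ∫ t in Icc (-r) r, |t| ^ s = ∫ t, (Iic r).indicator (fun t : ℝ => t ^ s) |t| := by
    rw [← integral_indicator measurableSet_Icc]
    refine integral_congr_ae (ae_of_all _ fun t => ?_)
    simp only [indicator_apply, mem_Icc, mem_Iic, abs_le]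
  rw [h1, integral_comp_abs, setIntegral_indicator measurableSet_Iic, Ioi_inter_Iic,
    ← intervalIntegral.integral_of_le hr.le, integral_rpow (Or.inl hs),
    zero_rpow (by linarith)]
  ring

lemma setIntegral_Icc_sub_add_abs_rpow_le {s : ℝ} (hs : -1 < s) (hs0 : s ≤ 0) (c : ℝ)
    {r : ℝ} (hr : 0 < r) :
    ∫ t in Icc (c - r) (c + r), |t| ^ s ≤ (2 / (s + 1) + 2) * r ^ (s + 1) := by
  have hi : Integrable ((Icc (-r) r).indicator fun t : ℝ => |t| ^ s) :=
    (integrableOn_Icc_abs_rpow hs _ _).integrable_indicator measurableSet_Icc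
  have hc : IntegrableOn (fun _ : ℝ => r ^ s) (Icc (c - r) (c + r)) :=
    integrableOn_const (by simp)
  have hnn : 0 ≤ (Icc (-r) r).indicator fun t : ℝ => |t| ^ s :=
    fun t => indicator_nonneg (fun t _ => by positivity) t
  calc ∫ t in Icc (c - r) (c + r), |t| ^ s
      ≤ ∫ t in Icc (c - r) (c + r), ((Icc (-r) r).indicator (fun t : ℝ => |t| ^ s) t + r ^ s) := by
        refine setIntegral_mono_on (integrableOn_Icc_abs_rpow hs _ _)
          (hi.integrableOn.add hc) measurableSet_Icc fun t _ => ?_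
        by_cases ht : t ∈ Icc (-r) r
        · rw [indicator_of_mem ht]
          linarith [rpow_pos_of_pos hr s]
        · rw [indicator_of_notMem ht, zero_add]
          refine rpow_le_rpow_of_nonpos hr ?_ hs0
          by_contra! h
          exact ht (abs_le.1 h.le)
    _ = (∫ t in Icc (c - r) (c + r), (Icc (-r) r).indicator (fun t : ℝ => |t| ^ s) t)
          + 2 * r * r ^ s := by
        rw [integral_add hi.integrableOn hc, setIntegral_const]
        simp only [measureReal_def, Real.volume_Icc, smul_eq_mul]
        rw [ENNReal.toReal_ofReal (by linarith)]
        ring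
    _ ≤ (∫ t, (Icc (-r) r).indicator (fun t : ℝ => |t| ^ s) t) + 2 * r * r ^ s := by
        have := setIntegral_le_integral (s := Icc (c - r) (c + r)) hi (ae_of_all _ hnn)
        linarith
    _ = (2 / (s + 1) + 2) * r ^ (s + 1) := by
        rw [integral_indicator measurableSet_Icc, setIntegral_Icc_abs_rpow hs hr, rpow_add_one hr.ne']
        ring

lemma setIntegral_ball_abs_coord_rpow_le {ι : Type*} [Fintype ι] (i₀ : ι) {s : ℝ} (hs : -1 < s)
    (hs0 : s ≤ 0) (x : EuclideanSpace ℝ ι) {r : ℝ} (hr : 0 < r) :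
    ∫ y in Metric.ball x r, |y i₀| ^ s ≤
      (2 / (s + 1) + 2) * 2 ^ (Fintype.card ι - 1) * r ^ (s + Fintype.card ι) := by
  classical
  let f : ι → ℝ → ℝ := fun i =>
    (Icc (x i - r) (x i + r)).indicator fun t => if i = i₀ then |t| ^ s else 1
  have hf : ∀ i, Integrable (f i) := by
    intro i
    refine IntegrableOn.integrable_indicator ?_ measurableSet_Icc
    by_cases hi : i = i₀
    · simpa [hi] using integrableOn_Icc_abs_rpow hs _ _
    · simp [hi]
  have hf0 : ∀ i t, 0 ≤ f i t := fun i t =>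
    indicator_nonneg (fun t _ => by dsimp only; split_ifs <;> positivity) t
  have hprod : Integrable fun z : ι → ℝ => ∏ i, f i (z i) := Integrable.fintype_prod hf
  have hprod' : Integrable fun y : EuclideanSpace ℝ ι => ∏ i, f i (y i) :=
    (PiLp.volume_preserving_ofLp ι).integrable_comp_of_integrable hprod
  calc ∫ y in Metric.ball x r, |y i₀| ^ s
      = ∫ y in Metric.ball x r, ∏ i, f i (y i) := by
        refine setIntegral_congr_fun Metric.isOpen_ball.measurableSet fun y hy => ?_
        have hmem : ∀ i, y i ∈ Icc (x i - r) (x i + r) := fun i => by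
          have h := (PiLp.norm_apply_le (y - x) i).trans (mem_ball_iff_norm.1 hy).le
          rw [PiLp.sub_apply, Real.norm_eq_abs, abs_le] at h
          constructor <;> linarith [h.1, h.2]
        simp [f, hmem]
    _ ≤ ∫ y : EuclideanSpace ℝ ι, ∏ i, f i (y i) :=
        setIntegral_le_integral hprod' (ae_of_all _ fun y => Finset.prod_nonneg fun i _ => hf0 i _)
    _ = ∫ z : ι → ℝ, ∏ i, f i (z i) :=
        (PiLp.volume_preserving_ofLp ι).integral_comp
          (MeasurableEquiv.toLp 2 (ι → ℝ)).symm.measurableEmbedding (fun z => ∏ i, f i (z i))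
    _ = ∏ i, ∫ t, f i t := integral_fintype_prod_volume_eq_prod f
    _ = (∫ t in Icc (x i₀ - r) (x i₀ + r), |t| ^ s) * (2 * r) ^ (Fintype.card ι - 1) := by
        rw [← Finset.mul_prod_erase _ _ (Finset.mem_univ i₀)]
        congr 1
        · simp only [f, if_true]
          exact integral_indicator measurableSet_Icc
        · rw [Finset.prod_congr rfl (g := fun _ => 2 * r) fun i hi => ?_]
          · simp [Finset.card_erase_of_mem]
          · simp only [f, if_neg (Finset.ne_of_mem_erase hi)]
            rw [integral_indicator measurableSet_Icc]
            simp only [setIntegral_const, measureReal_def, Real.volume_Icc, smul_eq_mul, mul_one]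
            rw [ENNReal.toReal_ofReal (by linarith)]
            ring
    _ ≤ ((2 / (s + 1) + 2) * r ^ (s + 1)) * (2 * r) ^ (Fintype.card ι - 1) := by
        gcongr
        exact setIntegral_Icc_sub_add_abs_rpow_le hs hs0 _ hr
    _ = _ := by
        have hcard : 1 ≤ Fintype.card ι := Fintype.card_pos_iff.2 ⟨i₀⟩
        have h : s + Fintype.card ι = (s + 1) + (Fintype.card ι - 1 : ℕ) := by
          push_cast [hcard]
          ring
        rw [h, rpow_add_natCast hr.ne', mul_pow]
        ring

/-- Lemma 2.1(i), upper bound (2.3): for `0 ≤ a < 1` with `aN < 2`,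
`h_x(r) = (∫_{B_r(x)} |y₁|^{-aN/2} dy)^{2/N} ≤ C r^{2-a}`. -/
theorem hx_upper_bound_nonneg_a
    (N : ℕ) (hN : 1 ≤ N) (a : ℝ) (ha1 : 0 ≤ a) (ha2 : a < 1) (haN : a * N < 2) :
    ∃ C : ℝ, 0 < C ∧ ∀ x : EuclideanSpace ℝ (Fin N), ∀ r : ℝ, 0 < r →
      (∫ y in Metric.ball x r, |y ⟨0, hN⟩| ^ (-(a * N) / 2)) ^ ((2 : ℝ) / N) ≤
        C * r ^ (2 - a) := by
  have hs : -1 < -(a * N) / 2 := by linarith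
  have hs0 : -(a * N) / 2 ≤ 0 := by
    have : 0 ≤ a * N := by positivity
    linarith
  have hN0 : (N : ℝ) ≠ 0 := by positivity
  have hK : 0 < (2 / (-(a * N) / 2 + 1) + 2) * 2 ^ (N - 1) := by
    have : 0 < -(a * N) / 2 + 1 := by linarith
    positivity
  refine ⟨_, rpow_pos_of_pos hK ((2 : ℝ) / N), fun x r hr => ?_⟩
  have hexp : 2 - a = (-(a * N) / 2 + N) * (2 / N) := by
    field_simp
    ring
  rw [hexp, rpow_mul hr.le, ← mul_rpow hK.le (by positivity)]
  refine rpow_le_rpow (integral_nonneg fun y => by positivity) ?_ (by positivity)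
  simpa using setIntegral_ball_abs_coord_rpow_le (⟨0, hN⟩ : Fin N) hs hs0 x hr
end

section
/- Let N ≥ 1 and let a be a real number with 0 ≤ a < 1 and aN < 2. Then there exists a constant C' > 0 such that for every x ∈ ℝ^N, writing x₁ for the first coordinate of x and h_x(r) := (∫_{B_r(x)} |y₁|^{−aN/2} dy)^{2/N}: h_x(r) ≥ C' r^2 |x₁|^{−a} whenever 0 < r ≤ |x₁|, and h_x(r) ≥ C' r^{2−a} whenever r ≥ |x₁| and r > 0. -/
open MeasureTheory Real Set
open scoped ENNReal

/-- A negative power of exponent above `-1` of the absolute value is integrable on balls of `ℝ`. -/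
theorem integrableOn_ball_abs_rpow_neg {p : ℝ} (hp : p < 1) (c r : ℝ) :
    IntegrableOn (fun t : ℝ => |t| ^ (-p)) (Metric.ball c r) := by
  have hloc : LocallyIntegrable (fun t : ℝ => |t| ^ (-p)) := by
    refine locallyIntegrable_of_norm_le_rpow (C := 1) (α := p) (by simp) (by simpa using hp)
      (ae_of_all _ fun t => ?_) (measurable_id.abs.pow_const _).aestronglyMeasurable
    rw [Real.norm_of_nonneg (by positivity), one_mul, Real.norm_eq_abs]
  exact (hloc.integrableOn_isCompact (isCompact_closedBall c r)).mono_set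
    Metric.ball_subset_closedBall

/-- A negative power of exponent above `-1` of a coordinate is integrable on Euclidean balls. -/
theorem EuclideanSpace.integrableOn_ball_abs_coord_rpow_neg {ι : Type*} [Fintype ι] {p : ℝ}
    (hp : p < 1) (i : ι) (x : EuclideanSpace ℝ ι) (r : ℝ) :
    IntegrableOn (fun y : EuclideanSpace ℝ ι => |y i| ^ (-p)) (Metric.ball x r) := by
  have hpi : IntegrableOn (fun z : ι → ℝ => |z i| ^ (-p))
      (univ.pi fun j => Metric.ball (x j) r) := by
    rw [IntegrableOn, volume_pi, Measure.restrict_pi_pi]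
    have (j : ι) : IsFiniteMeasure ((volume : Measure ℝ).restrict (Metric.ball (x j) r)) :=
      ⟨by simpa using (measure_ball_lt_top (μ := (volume : Measure ℝ)) (x := x j) (r := r))⟩
    exact integrable_comp_eval (X := fun _ : ι => ℝ)
      (μ := fun j => (volume : Measure ℝ).restrict (Metric.ball (x j) r))
      (f := fun t : ℝ => |t| ^ (-p))
      (integrableOn_ball_abs_rpow_neg hp (x i) r)
  have hbox := ((volume_preserving_symm_measurableEquiv_toLp ι).integrableOn_comp_preimage
    (MeasurableEquiv.measurableEmbedding _)).2 hpi
  refine hbox.mono_set fun y hy j _ => ?_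
  rw [Metric.mem_ball, dist_eq_norm] at hy ⊢
  exact (PiLp.norm_apply_le (y - x) j).trans_lt hy

/-- Almost every point of Euclidean space has a nonzero `i`-th coordinate. -/
theorem EuclideanSpace.ae_coord_ne_zero {ι : Type*} [Fintype ι] (i : ι) :
    ∀ᵐ y : EuclideanSpace ℝ ι, y i ≠ 0 :=
  ((Measure.quasiMeasurePreserving_eval (fun _ : ι => (volume : Measure ℝ)) i).comp
    (PiLp.volume_preserving_ofLp ι).quasiMeasurePreserving).ae (Measure.ae_ne volume 0)

/-- The integral of `|yᵢ| ^ (-p)` over a ball is at least the volume of the ball times the value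
of the integrand at distance `2 * M` from the hyperplane `yᵢ = 0`. -/
theorem EuclideanSpace.rpow_mul_volume_ball_le_setIntegral {ι : Type*} [Fintype ι] {p : ℝ}
    (hp0 : 0 ≤ p) (hp : p < 1) (i : ι) (x : EuclideanSpace ℝ ι) {r M : ℝ}
    (hrM : r ≤ M) (hxM : |x i| ≤ M) :
    (2 * M) ^ (-p) * volume.real (Metric.ball x r) ≤
      ∫ y in Metric.ball x r, |y i| ^ (-p) := by
  calc (2 * M) ^ (-p) * volume.real (Metric.ball x r)
      = ∫ _ in Metric.ball x r, (2 * M) ^ (-p) := by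
        rw [setIntegral_const, smul_eq_mul, mul_comm]
    _ ≤ _ := by
      refine setIntegral_mono_on_ae (integrableOn_const measure_ball_lt_top.ne)
        (integrableOn_ball_abs_coord_rpow_neg hp i x r) measurableSet_ball ?_
      filter_upwards [ae_coord_ne_zero i] with y hy0 hy
      rw [Metric.mem_ball, dist_eq_norm] at hy
      have hcoord : |y i - x i| < r := (PiLp.norm_apply_le (y - x) i).trans_lt hy
      have htri : |y i| ≤ |y i - x i| + |x i| := by
        simpa using abs_add_le (y i - x i) (x i)
      exact Real.rpow_le_rpow_of_nonpos (abs_pos.2 hy0) (by linarith) (by linarith)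

/-- A lower bound for the normalized weight integral over a ball of radius `r`, for any `M` dominating
both `r` and the `i`-th coordinate of the center. -/
theorem EuclideanSpace.le_setIntegral_ball_abs_coord_rpow {N : ℕ} (hN : 1 ≤ N) {a : ℝ}
    (ha : 0 ≤ a) (haN : a * N < 2) (i : Fin N) (x : EuclideanSpace ℝ (Fin N)) {r M : ℝ}
    (hr : 0 < r) (hrM : r ≤ M) (hxM : |x i| ≤ M) :
    2 ^ (-a) * volume.real (Metric.ball (0 : EuclideanSpace ℝ (Fin N)) 1) ^ ((2 : ℝ) / N) *
        (r ^ (2 : ℝ) * M ^ (-a)) ≤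
      (∫ y in Metric.ball x r, |y i| ^ (-(a * N) / 2)) ^ ((2 : ℝ) / N) := by
  have hN' : (0 : ℝ) < N := by exact_mod_cast hN
  have hM : 0 < M := hr.trans_le hrM
  have hvol : volume.real (Metric.ball x r) =
      r ^ (N : ℝ) * volume.real (Metric.ball (0 : EuclideanSpace ℝ (Fin N)) 1) := by
    rw [measureReal_def, Measure.addHaar_ball_of_pos _ _ hr, ENNReal.toReal_mul,
      ENNReal.toReal_ofReal (by positivity), finrank_euclideanSpace_fin, Real.rpow_natCast,
      measureReal_def]
  have hmain := rpow_mul_volume_ball_le_setIntegral (p := a * N / 2) (by positivity)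
    (by linarith) i x hrM hxM
  rw [hvol] at hmain
  rw [neg_div]
  refine le_trans (le_of_eq ?_) (Real.rpow_le_rpow (by positivity) hmain (by positivity))
  rw [Real.mul_rpow (by positivity) (by positivity),
    Real.mul_rpow (x := r ^ (N : ℝ)) (by positivity) (by positivity),
    ← Real.rpow_mul (by positivity), ← Real.rpow_mul hr.le,
    show -(a * N / 2) * (2 / N) = -a by field_simp, show (N : ℝ) * (2 / N) = 2 by field_simp,
    Real.mul_rpow (by positivity) hM.le]
  ring

/-- Lemma 2.1(i), lower bound (2.4): for `0 ≤ a < 1` with `aN < 2`,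
`h_x(r) ≥ C' r^2 |x₁|^{-a}` for `0 < r ≤ |x₁|` and `h_x(r) ≥ C' r^{2-a}` for
`r ≥ |x₁|`, where `h_x(r) = (∫_{B_r(x)} |y₁|^{-aN/2} dy)^{2/N}`. -/
theorem hx_lower_bound_nonneg_a
    (N : ℕ) (hN : 1 ≤ N) (a : ℝ) (ha1 : 0 ≤ a) (ha2 : a < 1) (haN : a * N < 2) :
    ∃ C' : ℝ, 0 < C' ∧ ∀ x : EuclideanSpace ℝ (Fin N),
      (∀ r : ℝ, 0 < r → r ≤ |x ⟨0, hN⟩| →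
        C' * (r ^ (2 : ℝ) * |x ⟨0, hN⟩| ^ (-a)) ≤
          (∫ y in Metric.ball x r, |y ⟨0, hN⟩| ^ (-(a * N) / 2)) ^ ((2 : ℝ) / N)) ∧
      (∀ r : ℝ, 0 < r → |x ⟨0, hN⟩| ≤ r →
        C' * r ^ (2 - a) ≤
          (∫ y in Metric.ball x r, |y ⟨0, hN⟩| ^ (-(a * N) / 2)) ^ ((2 : ℝ) / N)) := by
  refine ⟨2 ^ (-a) * volume.real (Metric.ball (0 : EuclideanSpace ℝ (Fin N)) 1) ^ ((2 : ℝ) / N),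
    ?_, fun x => ⟨fun r hr hrx => ?_, fun r hr hxr => ?_⟩⟩
  · have hball : 0 < volume.real (Metric.ball (0 : EuclideanSpace ℝ (Fin N)) 1) :=
      ENNReal.toReal_pos (Metric.measure_ball_pos _ _ one_pos).ne' measure_ball_lt_top.ne
    positivity
  · exact EuclideanSpace.le_setIntegral_ball_abs_coord_rpow hN ha1 haN _ x hr hrx le_rfl
  · rw [sub_eq_add_neg, Real.rpow_add hr]
    exact EuclideanSpace.le_setIntegral_ball_abs_coord_rpow hN ha1 haN _ x hr le_rfl hxr
end

section
/- Let N ≥ 1 and let a be a real number with −1 < a < 0. Then there exists a constant C > 0 such that for every x ∈ ℝ^N, writing x₁ for the first coordinate of x and h_x(r) := (∫_{B_r(x)} |y₁|^{−aN/2} dy)^{2/N}: h_x(r) ≤ C r^2 |x₁|^{−a} whenever 0 < r ≤ |x₁|, and h_x(r) ≤ C r^{2−a} whenever r ≥ |x₁| and r > 0. -/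
open MeasureTheory Real Set
open scoped ENNReal

/-- A ball of radius `r ≤ M` whose center has `i`-th coordinate at most `M` in absolute value lies
in the slab `|y i| ≤ 2 * M`, which bounds the integral of a nonnegative power of `|y i|` over it. -/
theorem setIntegral_ball_abs_coord_rpow_le_s9 {N : ℕ} (i : Fin N) {p : ℝ} (hp : 0 ≤ p)
    (x : EuclideanSpace ℝ (Fin N)) {r M : ℝ} (hr : 0 < r) (hrM : r ≤ M) (hxM : |x i| ≤ M) :
    ∫ y in Metric.ball x r, |y i| ^ p ≤
      (2 * M) ^ p * (r ^ N * volume.real (Metric.ball (0 : EuclideanSpace ℝ (Fin N)) 1)) := by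
  have hvol : volume.real (Metric.ball x r) =
      r ^ N * volume.real (Metric.ball (0 : EuclideanSpace ℝ (Fin N)) 1) := by
    rw [Measure.real, Measure.addHaar_ball_of_pos volume x hr, ENNReal.toReal_mul,
      ENNReal.toReal_ofReal (by positivity), finrank_euclideanSpace_fin, Measure.real]
  rw [← hvol]
  refine (Real.le_norm_self _).trans
    (norm_setIntegral_le_of_norm_le_const measure_ball_lt_top fun y hy => ?_)
  have hcoord : |y i - x i| ≤ r := by
    have h := PiLp.norm_apply_le (y - x) i
    rw [← dist_eq_norm] at h
    exact h.trans (Metric.mem_ball.mp hy).le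
  have hy : |y i| ≤ 2 * M := by
    have h := abs_add_le (y i - x i) (x i)
    rw [sub_add_cancel] at h
    linarith
  rw [Real.norm_of_nonneg (by positivity)]
  exact rpow_le_rpow (abs_nonneg _) hy hp

theorem rpow_setIntegral_ball_abs_coord_le {N : ℕ} (i : Fin N) {a : ℝ} (ha : a ≤ 0)
    (x : EuclideanSpace ℝ (Fin N)) {r M : ℝ} (hr : 0 < r) (hrM : r ≤ M) (hxM : |x i| ≤ M) :
    (∫ y in Metric.ball x r, |y i| ^ (-(a * N) / 2)) ^ ((2 : ℝ) / N) ≤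
      (2 ^ (-a) * volume.real (Metric.ball (0 : EuclideanSpace ℝ (Fin N)) 1) ^ ((2 : ℝ) / N)) *
        (r ^ (2 : ℝ) * M ^ (-a)) := by
  have hN : (N : ℝ) ≠ 0 := Nat.cast_ne_zero.mpr (Fin.pos i).ne'
  have hM : 0 < M := hr.trans_le hrM
  have hp : 0 ≤ -(a * N) / 2 := by
    have := mul_nonpos_of_nonpos_of_nonneg ha (Nat.cast_nonneg (α := ℝ) N)
    linarith
  refine (rpow_le_rpow (integral_nonneg fun y => by positivity)
    (setIntegral_ball_abs_coord_rpow_le_s9 i hp x hr hrM hxM) (by positivity)).trans_eq ?_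
  rw [mul_rpow (x := (2 * M) ^ _) (by positivity) (by positivity),
    mul_rpow (x := r ^ N) (by positivity) (by positivity), ← rpow_mul (by positivity), ← rpow_natCast r N, ← rpow_mul hr.le,
    show -(a * N) / 2 * (2 / N) = -a by field_simp, mul_div_cancel₀ _ hN,
    mul_rpow zero_le_two hM.le]
  ring

/-- Lemma 2.1(ii), upper bound (2.5): for `-1 < a < 0`,
`h_x(r) ≤ C r^2 |x₁|^{-a}` for `0 < r ≤ |x₁|` and `h_x(r) ≤ C r^{2-a}` for
`r ≥ |x₁|`, where `h_x(r) = (∫_{B_r(x)} |y₁|^{-aN/2} dy)^{2/N}`. -/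
theorem hx_upper_bound_neg_a
    (N : ℕ) (hN : 1 ≤ N) (a : ℝ) (ha1 : -1 < a) (ha2 : a < 0) :
    ∃ C : ℝ, 0 < C ∧ ∀ x : EuclideanSpace ℝ (Fin N),
      (∀ r : ℝ, 0 < r → r ≤ |x ⟨0, hN⟩| →
        (∫ y in Metric.ball x r, |y ⟨0, hN⟩| ^ (-(a * N) / 2)) ^ ((2 : ℝ) / N) ≤
          C * (r ^ (2 : ℝ) * |x ⟨0, hN⟩| ^ (-a))) ∧
      (∀ r : ℝ, 0 < r → |x ⟨0, hN⟩| ≤ r →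
        (∫ y in Metric.ball x r, |y ⟨0, hN⟩| ^ (-(a * N) / 2)) ^ ((2 : ℝ) / N) ≤
          C * r ^ (2 - a)) := by
  have hV : 0 < volume.real (Metric.ball (0 : EuclideanSpace ℝ (Fin N)) 1) :=
    ENNReal.toReal_pos (Metric.measure_ball_pos _ _ one_pos).ne' measure_ball_lt_top.ne
  refine ⟨2 ^ (-a) * volume.real (Metric.ball (0 : EuclideanSpace ℝ (Fin N)) 1) ^ ((2 : ℝ) / N),
    by positivity, fun x => ⟨fun r hr hrx => ?_, fun r hr hxr => ?_⟩⟩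
  · exact rpow_setIntegral_ball_abs_coord_le _ ha2.le x hr hrx le_rfl
  · rw [sub_eq_add_neg, rpow_add hr]
    exact rpow_setIntegral_ball_abs_coord_le _ ha2.le x hr le_rfl hxr
end

section
/- Let N ≥ 1 and let a be a real number with −1 < a < 0. Then there exists a constant C' > 0 such that for every x ∈ ℝ^N and every r > 0, h_x(r) := (∫_{B_r(x)} |y₁|^{−aN/2} dy)^{2/N} ≥ C' r^{2−a}, where y₁ denotes the first coordinate of y. -/
open MeasureTheory Real Set
open scoped ENNReal

/-- Every ball of radius `r` contains a ball of radius `r / 4` on which a given coordinate is at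
least `r / 4` in absolute value. -/
lemma exists_ball_subset_ball_abs_coord_ge {ι : Type*} [Fintype ι] (i : ι)
    (x : EuclideanSpace ℝ ι) {r : ℝ} (hr : 0 < r) :
    ∃ z, Metric.ball z (r / 4) ⊆ Metric.ball x r ∧
      ∀ y ∈ Metric.ball z (r / 4), r / 4 ≤ |y i| := by
  classical
  obtain ⟨t, ht, hxt⟩ : ∃ t : ℝ, |t| = r / 2 ∧ r / 2 ≤ |x i + t| := by
    rcases le_total 0 (x i) with h | h
    · exact ⟨r / 2, abs_of_pos (by positivity), le_trans (by linarith) (le_abs_self _)⟩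
    · exact ⟨-(r / 2), by rw [abs_neg, abs_of_pos (by positivity)],
        le_trans (by linarith) (neg_le_abs _)⟩
  refine ⟨x + EuclideanSpace.single i t, Metric.ball_subset_ball' ?_, fun y hy => ?_⟩
  · rw [dist_self_add_left, PiLp.norm_single, Real.norm_eq_abs, ht]
    linarith
  · have h1 := (PiLp.norm_apply_le (y - (x + EuclideanSpace.single i t)) i).trans_lt
      (mem_ball_iff_norm.1 hy)
    simp only [PiLp.sub_apply, PiLp.add_apply, PiLp.single_apply, if_true,
      Real.norm_eq_abs] at h1
    have h2 := abs_sub_abs_le_abs_sub (x i + t) (y i)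
    rw [abs_sub_comm] at h2
    linarith

/-- The integral of `|y i| ^ p` over a ball of radius `r` is at least a multiple, independent of
the centre, of `r ^ (p + N)`, where `N` is the dimension. -/
lemma le_setIntegral_ball_abs_coord_rpow {ι : Type*} [Fintype ι] (i : ι) {p : ℝ} (hp : 0 ≤ p)
    (x : EuclideanSpace ℝ ι) {r : ℝ} (hr : 0 < r) :
    volume.real (Metric.ball (0 : EuclideanSpace ℝ ι) 1) * (r / 4) ^ (p + Fintype.card ι) ≤
      ∫ y in Metric.ball x r, |y i| ^ p := by
  obtain ⟨z, hzx, hz⟩ := exists_ball_subset_ball_abs_coord_ge i x hr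
  have hcont : Continuous fun y : EuclideanSpace ℝ ι => |y i| ^ p :=
    Continuous.rpow_const (by fun_prop) fun _ => Or.inr hp
  have hint : IntegrableOn (fun y : EuclideanSpace ℝ ι => |y i| ^ p) (Metric.ball x r) :=
    (hcont.continuousOn.integrableOn_compact (isCompact_closedBall x r)).mono_set
      Metric.ball_subset_closedBall
  calc volume.real (Metric.ball (0 : EuclideanSpace ℝ ι) 1) * (r / 4) ^ (p + Fintype.card ι)
      = (r / 4) ^ p * volume.real (Metric.ball z (r / 4)) := by
        rw [measureReal_def _ (Metric.ball z (r / 4)),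
          Measure.addHaar_ball_of_pos _ _ (by positivity), ENNReal.toReal_mul, ← measureReal_def,
          ENNReal.toReal_ofReal (by positivity), finrank_euclideanSpace,
          rpow_add (by positivity), rpow_natCast]
        ring
    _ ≤ ∫ y in Metric.ball z (r / 4), |y i| ^ p :=
        setIntegral_ge_of_const_le_real measurableSet_ball measure_ball_lt_top.ne
          (fun y hy => rpow_le_rpow (by positivity) (hz y hy) hp) (hint.mono_set hzx)
    _ ≤ ∫ y in Metric.ball x r, |y i| ^ p :=
        setIntegral_mono_set hint (.of_forall fun y => by positivity) hzx.eventuallyLE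

/-- Lemma 2.1(ii), lower bound (2.6): for `-1 < a < 0`,
`h_x(r) = (∫_{B_r(x)} |y₁|^{-aN/2} dy)^{2/N} ≥ C' r^{2-a}`. -/
theorem hx_lower_bound_neg_a
    (N : ℕ) (hN : 1 ≤ N) (a : ℝ) (ha1 : -1 < a) (ha2 : a < 0) :
    ∃ C' : ℝ, 0 < C' ∧ ∀ x : EuclideanSpace ℝ (Fin N), ∀ r : ℝ, 0 < r →
      C' * r ^ (2 - a) ≤
        (∫ y in Metric.ball x r, |y ⟨0, hN⟩| ^ (-(a * N) / 2)) ^ ((2 : ℝ) / N) := by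
  have hN' : (0 : ℝ) < N := by exact_mod_cast hN
  have hp : 0 ≤ -(a * N) / 2 := by nlinarith
  set ω := volume.real (Metric.ball (0 : EuclideanSpace ℝ (Fin N)) 1)
  have hω : 0 < ω := ENNReal.toReal_pos (Metric.measure_ball_pos _ _ one_pos).ne'
    measure_ball_lt_top.ne
  refine ⟨ω ^ ((2 : ℝ) / N) * (1 / 4) ^ (2 - a), by positivity, fun x r hr => ?_⟩
  have key := le_setIntegral_ball_abs_coord_rpow (⟨0, hN⟩ : Fin N) hp x hr
  rw [Fintype.card_fin] at key
  calc ω ^ ((2 : ℝ) / N) * (1 / 4) ^ (2 - a) * r ^ (2 - a)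
      = (ω * (r / 4) ^ (-(a * N) / 2 + N)) ^ ((2 : ℝ) / N) := by
        rw [mul_rpow hω.le (by positivity), ← rpow_mul (by positivity), mul_assoc,
          ← mul_rpow (by norm_num) hr.le]
        congr 2
        · ring
        · field_simp
          ring
    _ ≤ _ := rpow_le_rpow (by positivity) key (by positivity)
end
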